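/- Let E be a real inner product space, n ≥ 2 and 1 ≤ τ ≤ n integers. Let φ_1, …, φ_n : E → ℝ be convex and differentiable with each φ_j L_j-smooth (L_j > 0), and suppose f := (1/n)·Σ_{j=1}^n φ_j is convex and L-smooth with L > 0. Define L(τ) := ((n−τ)/(τ(n−1)))·max_j L_j + (n(τ−1)/(τ(n−1)))·L. Then for all x, y ∈ E, (1/binom(n,τ))·Σ_{S ⊆ {1,…,n}, |S| = τ} ‖(1/τ)·Σ_{j∈S} (∇φ_j(x) − ∇φ_j(y))‖² ≤ 2·L(τ)·D_f(x, y). -/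

import Mathlib

open RealInnerProductSpace

/-- A convex function lies above its tangent hyperplanes. -/
theorem ConvexOn.bregman_nonneg {E : Type*} [NormedAddCommGroup E] [InnerProductSpace ℝ E]
    {h : E → ℝ} {g y : E} (hc : ConvexOn ℝ Set.univ h)
    (hd : HasFDerivAt h ((innerSL ℝ) g) y) (x : E) :
    0 ≤ h x - h y - ⟪g, x - y⟫ := by
  have hline : ConvexOn ℝ Set.univ (h ∘ AffineMap.lineMap (k := ℝ) y x) := by
    simpa using hc.comp_affineMap (AffineMap.lineMap (k := ℝ) y x)
  have hderiv : HasDerivAt (h ∘ AffineMap.lineMap (k := ℝ) y x) ⟪g, x - y⟫ 0 := by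
    have hd' : HasFDerivAt h ((innerSL ℝ) g) (AffineMap.lineMap (k := ℝ) y x (0 : ℝ)) := by
      simpa using hd
    simpa using hd'.comp_hasDerivAt (0 : ℝ) AffineMap.hasDerivAt_lineMap
  have hslope := hline.le_slope_of_hasDerivAt (Set.mem_univ 0) (Set.mem_univ 1) one_pos hderiv
  simp only [slope_def_field, Function.comp_apply, AffineMap.lineMap_apply_one,
    AffineMap.lineMap_apply_zero, sub_zero, div_one] at hslope
  linarith

/-- Cocoercivity: if the Bregman divergence of `h` is nonnegative and bounded by `L / 2 * ‖x - y‖ ^ 2`,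
then it controls squared gradient differences. -/
theorem norm_sq_gradient_sub_le_bregman {E : Type*} [NormedAddCommGroup E] [InnerProductSpace ℝ E]
    {h : E → ℝ} {h' : E → E} {L : ℝ} (hL : 0 < L)
    (hnonneg : ∀ x y, 0 ≤ h x - h y - ⟪h' y, x - y⟫)
    (hsmooth : ∀ x y, h x - h y - ⟪h' y, x - y⟫ ≤ L / 2 * ‖x - y‖ ^ 2) (x y : E) :
    ‖h' x - h' y‖ ^ 2 ≤ 2 * L * (h x - h y - ⟪h' y, x - y⟫) := by
  set d := h' x - h' y with hd
  have hlower := hnonneg (x - L⁻¹ • d) y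
  have hupper := hsmooth (x - L⁻¹ • d) x
  have hinner : ⟪h' x, d⟫ - ⟪h' y, d⟫ = ‖d‖ ^ 2 := by
    rw [← inner_sub_left, ← hd, real_inner_self_eq_norm_sq]
  rw [show x - L⁻¹ • d - y = (x - y) - L⁻¹ • d by abel, inner_sub_right, inner_smul_right]
    at hlower
  rw [show x - L⁻¹ • d - x = -(L⁻¹ • d) by abel, inner_neg_right, inner_smul_right, norm_neg,
    norm_smul, mul_pow, Real.norm_eq_abs, sq_abs] at hupper
  have hscale : L / 2 * (L⁻¹ ^ 2 * ‖d‖ ^ 2) = L⁻¹ * ‖d‖ ^ 2 / 2 := by field_simp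
  have hbound : L⁻¹ * ‖d‖ ^ 2 ≤ 2 * (h x - h y - ⟪h' y, x - y⟫) := by
    rw [hscale] at hupper
    have := congrArg (L⁻¹ * ·) hinner
    simp only [mul_sub] at this
    linarith
  rw [inv_mul_le_iff₀ hL] at hbound
  linarith

/-- Double counting of pairs consisting of a `k`-subset of `t` and a subset of it of the size of
`s`. -/
theorem Finset.choose_mul_card_filter_powersetCard_subset {α : Type*} [DecidableEq α]
    {s t : Finset α} (hst : s ⊆ t) (k : ℕ) :
    t.card.choose s.card * ((t.powersetCard k).filter (s ⊆ ·)).card =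
      t.card.choose k * k.choose s.card := by
  rcases le_or_gt s.card k with hk | hk
  · rw [Finset.card_filter_powersetCard_subset s t k hst hk, Nat.choose_mul hk]
  · have hempty : (t.powersetCard k).filter (s ⊆ ·) = ∅ := by
      refine Finset.filter_eq_empty_iff.mpr fun S hS hsS => ?_
      have := Finset.card_le_card hsS
      rw [(Finset.mem_powersetCard.mp hS).2] at this
      omega
    rw [Nat.choose_eq_zero_of_lt hk, hempty, Finset.card_empty, mul_zero, mul_zero]

/-- The second moment of the sum over a uniformly random `k`-element subset. -/
theorem Finset.sum_powersetCard_norm_sum_sq {ι E : Type*} [Fintype ι] [NormedAddCommGroup E]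
    [InnerProductSpace ℝ E] (hι : 2 ≤ Fintype.card ι) (k : ℕ) (v : ι → E) :
    ∑ S ∈ Finset.powersetCard k (Finset.univ : Finset ι), ‖∑ j ∈ S, v j‖ ^ 2 =
      ((Fintype.card ι).choose k : ℝ) * (k / (Fintype.card ι * ((Fintype.card ι : ℝ) - 1))) *
        (((Fintype.card ι : ℝ) - k) * ∑ j, ‖v j‖ ^ 2 + ((k : ℝ) - 1) * ‖∑ j, v j‖ ^ 2) := by
  classical
  set N := Fintype.card ι with hN
  have hN2 : (2 : ℝ) ≤ N := by exact_mod_cast hι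
  have hN0 : (N : ℝ) ≠ 0 := by linarith
  have hN1 : (N : ℝ) - 1 ≠ 0 := by linarith
  set c : ℝ := (N.choose k : ℝ) * (k / (N * ((N : ℝ) - 1))) with hc
  have hcount (i j : ι) :
      (((Finset.powersetCard k Finset.univ).filter (({i, j} : Finset ι) ⊆ ·)).card : ℝ) =
        c * (k - 1) + if i = j then c * (N - k) else 0 := by
    have h := Finset.choose_mul_card_filter_powersetCard_subset
      (Finset.subset_univ ({i, j} : Finset ι)) k
    rw [Finset.card_univ, ← hN] at h
    have h' := congrArg (Nat.cast (R := ℝ)) h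
    rw [Nat.cast_mul, Nat.cast_mul] at h'
    by_cases hij : i = j
    · subst hij
      simp only [Finset.pair_eq_singleton, Finset.card_singleton, Nat.choose_one_right] at h' ⊢
      rw [if_pos trivial, ← mul_right_inj' hN0, h', hc]
      field_simp
      ring
    · rw [Finset.card_pair hij, Nat.cast_choose_two, Nat.cast_choose_two] at h'
      rw [if_neg hij, add_zero, hc]
      field_simp
      linarith
  have hexpand (S : Finset ι) : ‖∑ j ∈ S, v j‖ ^ 2 =
      ∑ i, ∑ j, if {i, j} ⊆ S then ⟪v i, v j⟫ else 0 := by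
    simp only [Finset.insert_subset_iff, Finset.singleton_subset_iff, ite_and]
    rw [← real_inner_self_eq_norm_sq, sum_inner, ← Finset.sum_subset (Finset.subset_univ S)]
    · refine Finset.sum_congr rfl fun i hi => ?_
      simp [hi, inner_sum]
    · intro i _ hi
      simp [hi]
  have htotal : ∑ i, ∑ j, ⟪v i, v j⟫ = ‖∑ j, v j‖ ^ 2 := by
    rw [← real_inner_self_eq_norm_sq, sum_inner]
    simp only [inner_sum]
  calc ∑ S ∈ Finset.powersetCard k Finset.univ, ‖∑ j ∈ S, v j‖ ^ 2
      = ∑ i, ∑ j, (c * (k - 1) + if i = j then c * (N - k) else 0) * ⟪v i, v j⟫ := by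
        simp only [hexpand]
        rw [Finset.sum_comm]
        refine Finset.sum_congr rfl fun i _ => ?_
        rw [Finset.sum_comm]
        refine Finset.sum_congr rfl fun j _ => ?_
        rw [← hcount, ← Finset.sum_filter, Finset.sum_const, nsmul_eq_mul]
    _ = c * ((N - k) * ∑ j, ‖v j‖ ^ 2 + (k - 1) * ‖∑ j, v j‖ ^ 2) := by
        simp only [add_mul, ite_mul, zero_mul, Finset.sum_add_distrib, Finset.sum_ite_eq,
          Finset.mem_univ, if_true, real_inner_self_eq_norm_sq, ← Finset.mul_sum, htotal]
        ring

/-- Lemma D.1 (τ-nice minibatch sampling): the minibatch gradient estimator satisfies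
the expected smoothness inequality with constant
`L(τ) = ((n−τ)/(τ(n−1)))·max_j L_j + (n(τ−1)/(τ(n−1)))·L`. -/
theorem minibatch_expected_smoothness
    {E : Type*} [NormedAddCommGroup E] [InnerProductSpace ℝ E]
    (n τ : ℕ) (hn : 2 ≤ n) (hτ1 : 1 ≤ τ) (hτn : τ ≤ n)
    (φ : Fin n → E → ℝ) (φ' : Fin n → E → E)
    (hconv : ∀ j, ConvexOn ℝ Set.univ (φ j))
    (hdiff : ∀ j z, HasFDerivAt (φ j) ((innerSL ℝ) (φ' j z)) z)
    (Lj : Fin n → ℝ) (hLj : ∀ j, 0 < Lj j)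
    (hsmoothj : ∀ j x y, φ j x - φ j y - ⟪φ' j y, x - y⟫ ≤ Lj j / 2 * ‖x - y‖ ^ 2)
    (Lmax : ℝ) (hLmax : IsGreatest (Set.range Lj) Lmax)
    (f : E → ℝ) (hf : f = fun x => ((n : ℝ))⁻¹ * ∑ j, φ j x)
    (f' : E → E) (hf' : ∀ z, f' z = ((n : ℝ))⁻¹ • ∑ j, φ' j z)
    (hfconv : ConvexOn ℝ Set.univ f)
    (L : ℝ) (hL : 0 < L)
    (hsmooth : ∀ x y, f x - f y - ⟪f' y, x - y⟫ ≤ L / 2 * ‖x - y‖ ^ 2)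
    (Lτ : ℝ)
    (hLτ : Lτ = ((n : ℝ) - τ) / (τ * ((n : ℝ) - 1)) * Lmax
        + (n : ℝ) * ((τ : ℝ) - 1) / (τ * ((n : ℝ) - 1)) * L) :
    ∀ x y : E,
      ((n.choose τ : ℝ))⁻¹ *
          ∑ S ∈ Finset.powersetCard τ (Finset.univ : Finset (Fin n)),
            ‖((τ : ℝ))⁻¹ • ∑ j ∈ S, (φ' j x - φ' j y)‖ ^ 2 ≤
        2 * Lτ * (f x - f y - ⟪f' y, x - y⟫) := by
  intro x y
  have hn2 : (2 : ℝ) ≤ n := by exact_mod_cast hn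
  have hτ : (1 : ℝ) ≤ τ := by exact_mod_cast hτ1
  have hτn' : (τ : ℝ) ≤ n := by exact_mod_cast hτn
  have hn0 : (0 : ℝ) < n := by linarith
  have hn1 : (0 : ℝ) < (n : ℝ) - 1 := by linarith
  have hτ0 : (0 : ℝ) < τ := by linarith
  have hchoose : (0 : ℝ) < n.choose τ := by exact_mod_cast Nat.choose_pos hτn
  have hbreg (j : Fin n) (x y : E) := (hconv j).bregman_nonneg (hdiff j y) x
  have hsum (x y : E) : ∑ j, (φ j x - φ j y - ⟪φ' j y, x - y⟫) =
      n * (f x - f y - ⟪f' y, x - y⟫) := by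
    rw [hf' y, hf, real_inner_smul_left, sum_inner, Finset.sum_sub_distrib,
      Finset.sum_sub_distrib]
    field_simp
  have hbregf (x y : E) : 0 ≤ f x - f y - ⟪f' y, x - y⟫ := by
    have h := Finset.sum_nonneg fun j (_ : j ∈ Finset.univ) => hbreg j x y
    rw [hsum] at h
    exact nonneg_of_mul_nonneg_right h hn0
  have hgrad : ∑ j, ‖φ' j x - φ' j y‖ ^ 2 ≤
      2 * Lmax * (n * (f x - f y - ⟪f' y, x - y⟫)) := by
    rw [← hsum, Finset.mul_sum]
    refine Finset.sum_le_sum fun j _ => ?_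
    refine (norm_sq_gradient_sub_le_bregman (hLj j) (hbreg j) (hsmoothj j) x y).trans ?_
    have := hLmax.2 (Set.mem_range_self j)
    have := hbreg j x y
    gcongr
  have hgradf := norm_sq_gradient_sub_le_bregman hL hbregf hsmooth x y
  have hmean : ‖∑ j, (φ' j x - φ' j y)‖ ^ 2 = (n : ℝ) ^ 2 * ‖f' x - f' y‖ ^ 2 := by
    rw [hf', hf', ← smul_sub, ← Finset.sum_sub_distrib, norm_smul, mul_pow, Real.norm_eq_abs,
      sq_abs]
    field_simp
  have hmoment := Finset.sum_powersetCard_norm_sum_sq (by simpa using hn) τ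
    fun j => φ' j x - φ' j y
  rw [Fintype.card_fin, hmean] at hmoment
  set D := f x - f y - ⟪f' y, x - y⟫
  simp only [norm_smul, mul_pow, Real.norm_eq_abs, sq_abs, ← Finset.mul_sum]
  rw [hmoment]
  calc _ = (τ * (n * ((n : ℝ) - 1)))⁻¹ * (((n : ℝ) - τ) * ∑ j, ‖φ' j x - φ' j y‖ ^ 2 +
        ((τ : ℝ) - 1) * (n ^ 2 * ‖f' x - f' y‖ ^ 2)) := by
        field_simp
    _ ≤ (τ * (n * ((n : ℝ) - 1)))⁻¹ * (((n : ℝ) - τ) * (2 * Lmax * (n * D)) +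
        ((τ : ℝ) - 1) * (n ^ 2 * (2 * L * D))) := by
        have := sub_nonneg.mpr hτn'
        have := sub_nonneg.mpr hτ
        gcongr
    _ = 2 * Lτ * D := by
        rw [hLτ]
        field_simp
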